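/- Let μ be a Borel probability measure on ℝ with characteristic function f(t) = ∫ e^{itx} dμ(x), let c ∈ ℝ and ε > 0, and suppose f(t) = exp(c t²/2) for all t with |t| < ε. Then c ≤ 0, μ is the Gaussian distribution N(0, −c), and consequently f(t) = exp(c t²/2) for all t ∈ ℝ. -/

import Mathlib

open MeasureTheory ProbabilityTheory

/-- Characteristic function of a Borel probability measure on `ℝ`. -/
noncomputable def charFunM (μ : Measure ℝ) (t : ℝ) : ℂ :=
  ∫ x, Complex.exp (Complex.I * (t * x)) ∂μ

open Filter Topology

section CharFunNearZero

variable {μ ν : Measure ℝ}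

/-- The real integrand `(2 - 2 cos (h x)) ^ k`, twisted by a character, is a combination of the
characters `x ↦ exp (i b x)` with `|b| ≤ |a| + k h`. -/
lemma integral_exp_mul_two_sub_two_cos_pow_eq [IsFiniteMeasure μ] [IsFiniteMeasure ν]
    {ε h : ℝ} (hh : 0 ≤ h) (hμν : ∀ t : ℝ, |t| < ε → charFun μ t = charFun ν t) (k : ℕ) :
    ∀ a : ℝ, |a| + k * h < ε →
      ∫ x, Complex.exp (a * x * Complex.I) * ((2 - 2 * Real.cos (h * x) : ℝ) : ℂ) ^ k ∂μ =
        ∫ x, Complex.exp (a * x * Complex.I) * ((2 - 2 * Real.cos (h * x) : ℝ) : ℂ) ^ k ∂ν := by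
  induction k with
  | zero =>
    intro a ha
    simpa [charFun_apply_real] using hμν a (by simpa using ha)
  | succ k ih =>
    intro a ha
    push_cast at ha
    let g (b x : ℝ) : ℂ :=
      Complex.exp (b * x * Complex.I) * ((2 - 2 * Real.cos (h * x) : ℝ) : ℂ) ^ k
    have hint (ρ : Measure ℝ) [IsFiniteMeasure ρ] (b : ℝ) : Integrable (g b) ρ := by
      refine Integrable.of_bound (by fun_prop) (4 ^ k) (ae_of_all _ fun x ↦ ?_)
      have h1 : ‖Complex.exp (b * x * Complex.I)‖ = 1 := by
        exact_mod_cast Complex.norm_exp_ofReal_mul_I (b * x)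
      rw [norm_mul, h1, one_mul, norm_pow, Complex.norm_real, Real.norm_eq_abs]
      gcongr
      rw [abs_le]
      constructor <;> linarith [Real.cos_le_one (h * x), Real.neg_one_le_cos (h * x)]
    have hrec (x : ℝ) : Complex.exp (a * x * Complex.I) *
        ((2 - 2 * Real.cos (h * x) : ℝ) : ℂ) ^ (k + 1) =
        2 * g a x - g (a + h) x - g (a - h) x := by
      have hcos : ((2 - 2 * Real.cos (h * x) : ℝ) : ℂ) =
          2 - Complex.exp (h * x * Complex.I) - Complex.exp (-(h * x * Complex.I)) := by
        push_cast
        rw [Complex.cos]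
        ring_nf
      have hadd : Complex.exp (((a + h : ℝ) : ℂ) * x * Complex.I) =
          Complex.exp (a * x * Complex.I) * Complex.exp (h * x * Complex.I) := by
        rw [← Complex.exp_add]
        push_cast
        ring_nf
      have hsub : Complex.exp (((a - h : ℝ) : ℂ) * x * Complex.I) =
          Complex.exp (a * x * Complex.I) * Complex.exp (-(h * x * Complex.I)) := by
        rw [← Complex.exp_add]
        push_cast
        ring_nf
      simp only [g]
      rw [hadd, hsub, pow_succ]
      nth_rewrite 2 [hcos]
      ring
    have hsplit (ρ : Measure ℝ) [IsFiniteMeasure ρ] :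
        ∫ x, (2 * g a x - g (a + h) x - g (a - h) x) ∂ρ =
          2 * ∫ x, g a x ∂ρ - ∫ x, g (a + h) x ∂ρ - ∫ x, g (a - h) x ∂ρ := by
      have hdiff : Integrable (fun x ↦ 2 * g a x - g (a + h) x) ρ :=
        ((hint ρ a).const_mul 2).sub (hint ρ _)
      rw [integral_sub hdiff (hint ρ _), integral_sub ((hint ρ a).const_mul 2) (hint ρ _), integral_const_mul]
    simp_rw [hrec]
    rw [hsplit μ, hsplit ν]
    have h1 := ih a (by linarith)
    have h2 := ih (a + h) (by linarith [abs_add_le a h, abs_of_nonneg hh])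
    have h3 := ih (a - h) (by linarith [abs_sub a h, abs_of_nonneg hh])
    simp only [g]
    rw [h1, h2, h3]

lemma lintegral_mul_sinc_pow_eq [IsFiniteMeasure μ] [IsFiniteMeasure ν] {ε h : ℝ} (hh : 0 < h)
    (hμν : ∀ t : ℝ, |t| < ε → charFun μ t = charFun ν t) (k : ℕ) (hk : k * (2 * h) < ε) :
    ∫⁻ x, ENNReal.ofReal ((x * Real.sinc (h * x)) ^ (2 * k)) ∂μ =
      ∫⁻ x, ENNReal.ofReal ((x * Real.sinc (h * x)) ^ (2 * k)) ∂ν := by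
  have hcos (x : ℝ) : (x * Real.sinc (h * x)) ^ (2 * k) =
      ((2 * h) ^ (2 * k))⁻¹ * (2 - 2 * Real.cos (2 * h * x)) ^ k := by
    have hsinc : x * Real.sinc (h * x) = h⁻¹ * Real.sin (h * x) := by
      rcases eq_or_ne x 0 with rfl | hx
      · simp
      · rw [Real.sinc_of_ne_zero (by positivity)]
        field_simp
    have hsq : 2 - 2 * Real.cos (2 * h * x) = (2 * Real.sin (h * x)) ^ 2 := by
      rw [mul_assoc, Real.cos_two_mul, mul_pow, Real.sin_sq]
      ring
    rw [hsinc, hsq, ← pow_mul, ← inv_pow, ← mul_pow]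
    congr 1
    field_simp
  have key := integral_exp_mul_two_sub_two_cos_pow_eq (by positivity : 0 ≤ 2 * h) hμν k 0
    (by simpa using hk)
  have hbochner : ∫ x, (2 - 2 * Real.cos (2 * h * x)) ^ k ∂μ =
      ∫ x, (2 - 2 * Real.cos (2 * h * x)) ^ k ∂ν := by
    simp only [Complex.ofReal_zero, zero_mul, Complex.exp_zero, one_mul, ← Complex.ofReal_pow,
      integral_complex_ofReal] at key
    exact_mod_cast key
  have hnonneg (x : ℝ) : 0 ≤ 2 - 2 * Real.cos (2 * h * x) := by
    linarith [Real.cos_le_one (2 * h * x)]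
  have hlint (ρ : Measure ℝ) [IsFiniteMeasure ρ] :
      ∫⁻ x, ENNReal.ofReal ((x * Real.sinc (h * x)) ^ (2 * k)) ∂ρ =
        ENNReal.ofReal (((2 * h) ^ (2 * k))⁻¹ *
          ∫ x, (2 - 2 * Real.cos (2 * h * x)) ^ k ∂ρ) := by
    have hint : Integrable (fun x ↦ (2 - 2 * Real.cos (2 * h * x)) ^ k) ρ := by
      refine Integrable.of_bound (by fun_prop) (4 ^ k) (ae_of_all _ fun x ↦ ?_)
      rw [norm_pow, Real.norm_of_nonneg (hnonneg x)]
      gcongr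
      · exact hnonneg x
      · linarith [Real.neg_one_le_cos (2 * h * x)]
    simp_rw [hcos]
    rw [← integral_const_mul, ofReal_integral_eq_lintegral_ofReal (hint.const_mul _)]
    exact ae_of_all _ fun x ↦ mul_nonneg (by positivity) (pow_nonneg (hnonneg x) k)
  rw [hlint μ, hlint ν, hbochner]

/-- If the characteristic functions of `μ` and `ν` agree near `0`, the even moments of `μ` are
bounded by those of `ν`. -/
lemma lintegral_even_pow_le_of_charFun_eq_near_zero [IsFiniteMeasure μ] [IsFiniteMeasure ν]
    {ε : ℝ} (hε : 0 < ε) (hμν : ∀ t : ℝ, |t| < ε → charFun μ t = charFun ν t) (k : ℕ) :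
    ∫⁻ x, ENNReal.ofReal (x ^ (2 * k)) ∂μ ≤ ∫⁻ x, ENNReal.ofReal (x ^ (2 * k)) ∂ν := by
  have hlim : Tendsto (fun n : ℕ ↦ 1 / ((n : ℝ) + 1)) atTop (𝓝 0) :=
    tendsto_one_div_add_atTop_nhds_zero_nat
  let F (n : ℕ) (x : ℝ) : ENNReal :=
    ENNReal.ofReal ((x * Real.sinc (1 / ((n : ℝ) + 1) * x)) ^ (2 * k))
  have hF (x : ℝ) : liminf (fun n ↦ F n x) atTop = ENNReal.ofReal (x ^ (2 * k)) := by
    refine Tendsto.liminf_eq (ENNReal.tendsto_ofReal ?_)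
    have h1 : Tendsto (fun n : ℕ ↦ Real.sinc (1 / ((n : ℝ) + 1) * x)) atTop (𝓝 1) := by
      rw [← Real.sinc_zero]
      refine (Real.continuous_sinc.tendsto 0).comp ?_
      simpa using hlim.mul_const x
    simpa using (h1.const_mul x).pow (2 * k)
  calc ∫⁻ x, ENNReal.ofReal (x ^ (2 * k)) ∂μ
      = ∫⁻ x, liminf (fun n ↦ F n x) atTop ∂μ := by simp_rw [hF]
    _ ≤ liminf (fun n ↦ ∫⁻ x, F n x ∂μ) atTop := by
      refine lintegral_liminf_le fun n ↦ ?_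
      have := Real.continuous_sinc
      exact (ENNReal.continuous_ofReal.comp (by fun_prop)).measurable
    _ ≤ ∫⁻ x, ENNReal.ofReal (x ^ (2 * k)) ∂ν := by
      refine liminf_le_of_frequently_le' (Eventually.frequently ?_)
      have hsmall : Tendsto (fun n : ℕ ↦ k * (2 * (1 / ((n : ℝ) + 1)))) atTop (𝓝 0) := by
        simpa using (hlim.const_mul 2).const_mul (k : ℝ)
      filter_upwards [hsmall.eventually_lt_const hε] with n hn
      rw [lintegral_mul_sinc_pow_eq (by positivity) hμν k hn]
      refine lintegral_mono fun x ↦ ENNReal.ofReal_le_ofReal ?_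
      rw [mul_pow]
      refine mul_le_of_le_one_right ((even_two_mul k).pow_nonneg x) ?_
      rw [← (even_two_mul k).pow_abs]
      exact pow_le_one₀ (abs_nonneg _) (Real.abs_sinc_le_one _)

lemma lintegral_cosh_le_of_charFun_eq_near_zero [IsFiniteMeasure μ] [IsFiniteMeasure ν]
    {ε : ℝ} (hε : 0 < ε) (hμν : ∀ t : ℝ, |t| < ε → charFun μ t = charFun ν t) (s : ℝ) :
    ∫⁻ x, ENNReal.ofReal (Real.cosh (s * x)) ∂μ ≤
      ∫⁻ x, ENNReal.ofReal (Real.cosh (s * x)) ∂ν := by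
  have hexpand (ρ : Measure ℝ) : ∫⁻ x, ENNReal.ofReal (Real.cosh (s * x)) ∂ρ =
      ∑' k : ℕ, ENNReal.ofReal (s ^ (2 * k) / (2 * k).factorial) *
        ∫⁻ x, ENNReal.ofReal (x ^ (2 * k)) ∂ρ := by
    have hcoeff (k : ℕ) : 0 ≤ s ^ (2 * k) / ((2 * k).factorial : ℝ) :=
      div_nonneg ((even_two_mul k).pow_nonneg s) (by positivity)
    have hterm (x : ℝ) : ENNReal.ofReal (Real.cosh (s * x)) =
        ∑' k : ℕ, ENNReal.ofReal (s ^ (2 * k) / (2 * k).factorial) *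
          ENNReal.ofReal (x ^ (2 * k)) := by
      have hs := Real.hasSum_cosh (s * x)
      rw [← hs.tsum_eq, ENNReal.ofReal_tsum_of_nonneg _ hs.summable]
      · refine tsum_congr fun k ↦ ?_
        rw [← ENNReal.ofReal_mul (hcoeff k), mul_pow]
        ring_nf
      · exact fun k ↦ div_nonneg ((even_two_mul k).pow_nonneg _) (by positivity)
    simp_rw [hterm]
    rw [lintegral_tsum fun k ↦ Measurable.aemeasurable (by fun_prop)]
    exact tsum_congr fun k ↦ lintegral_const_mul _ (by fun_prop)
  rw [hexpand μ, hexpand ν]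
  gcongr ∑' k, _ * ?_ with k
  exact lintegral_even_pow_le_of_charFun_eq_near_zero hε hμν k

/-- If `ν` has all exponential moments and the characteristic functions of `μ` and `ν` agree
near `0`, then `μ` has all exponential moments. -/
lemma integrableExpSet_eq_univ_of_charFun_eq_near_zero [IsFiniteMeasure μ] [IsFiniteMeasure ν]
    {ε : ℝ} (hε : 0 < ε) (hμν : ∀ t : ℝ, |t| < ε → charFun μ t = charFun ν t)
    (hν : integrableExpSet id ν = Set.univ) : integrableExpSet id μ = Set.univ := by
  refine Set.eq_univ_of_forall fun s ↦ ?_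
  have hexp (t : ℝ) : Integrable (fun x ↦ Real.exp (t * x)) ν :=
    integrable_of_mem_integrableExpSet (X := id) (hν ▸ Set.mem_univ t)
  have hcosh_nonneg (ρ : Measure ℝ) : 0 ≤ᵐ[ρ] fun x ↦ Real.cosh (s * x) :=
    ae_of_all _ fun x ↦ (Real.cosh_pos _).le
  have hcoshν : Integrable (fun x ↦ Real.cosh (s * x)) ν := by
    refine (((hexp s).add (hexp (-s))).div_const 2).congr (ae_of_all _ fun x ↦ ?_)
    simp [Real.cosh_eq]
  have hcoshμ : Integrable (fun x ↦ Real.cosh (s * x)) μ := by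
    have hmeas : AEStronglyMeasurable (fun x ↦ Real.cosh (s * x)) μ :=
      Continuous.aestronglyMeasurable (by fun_prop)
    refine (lintegral_ofReal_ne_top_iff_integrable hmeas (hcosh_nonneg μ)).1
      (ne_top_of_le_ne_top ?_ (lintegral_cosh_le_of_charFun_eq_near_zero hε hμν s))
    exact (lintegral_ofReal_ne_top_iff_integrable hcoshν.1 (hcosh_nonneg ν)).2 hcoshν
  refine (hcoshμ.const_mul 2).mono' (by fun_prop) (ae_of_all _ fun x ↦ ?_)
  rw [Real.norm_of_nonneg (Real.exp_pos _).le, Real.cosh_eq, id]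
  linarith [Real.exp_pos (-(s * x))]

/-- A finite measure with all exponential moments is determined, among finite measures, by the
values of its characteristic function near `0`. -/
theorem ext_of_charFun_eq_near_zero [IsFiniteMeasure μ] [IsFiniteMeasure ν]
    {ε : ℝ} (hε : 0 < ε) (hμν : ∀ t : ℝ, |t| < ε → charFun μ t = charFun ν t)
    (hν : integrableExpSet id ν = Set.univ) : μ = ν := by
  have hμ := integrableExpSet_eq_univ_of_charFun_eq_near_zero hε hμν hν
  have hanalytic {ρ : Measure ℝ} (hρ : integrableExpSet id ρ = Set.univ) :
      AnalyticOnNhd ℂ (complexMGF id ρ) Set.univ := by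
    simpa [hρ] using analyticOnNhd_complexMGF (X := id) (μ := ρ)
  have htendsto : Tendsto (fun t : ℝ ↦ (t : ℂ) * Complex.I) (𝓝[≠] 0) (𝓝[≠] 0) := by
    refine tendsto_nhdsWithin_iff.2 ⟨?_, ?_⟩
    · have hcont : Continuous fun t : ℝ ↦ (t : ℂ) * Complex.I := by fun_prop
      simpa using (hcont.tendsto 0).mono_left nhdsWithin_le_nhds
    · filter_upwards [self_mem_nhdsWithin] with t ht
      simpa using ht
  have hfreq : ∃ᶠ z in 𝓝[≠] (0 : ℂ), complexMGF id μ z = complexMGF id ν z := by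
    refine htendsto.frequently (Eventually.frequently ?_)
    filter_upwards [nhdsWithin_le_nhds (Metric.ball_mem_nhds (0 : ℝ) hε)] with t ht
    rw [complexMGF_id_mul_I, complexMGF_id_mul_I]
    exact hμν t (by simpa using ht)
  exact Measure.ext_of_complexMGF_id_eq
    ((hanalytic hμ).eq_of_frequently_eq (hanalytic hν) hfreq)

end CharFunNearZero

lemma charFunM_eq_charFun (μ : Measure ℝ) (t : ℝ) : charFunM μ t = charFun μ t := by
  rw [charFunM, charFun_apply_real]
  simp_rw [mul_comm Complex.I]

lemma charFun_gaussianReal_zero_mean {c : ℝ} (hc : c ≤ 0) (t : ℝ) :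
    charFun (gaussianReal 0 (-c).toNNReal) t = Complex.exp ((c : ℂ) * (t : ℂ) ^ 2 / 2) := by
  rw [charFun_gaussianReal]
  have hv : (((-c).toNNReal : ℝ) : ℂ) = -c := by
    rw [Real.coe_toNNReal _ (by linarith), Complex.ofReal_neg]
  rw [hv]
  congr 1
  push_cast
  ring

/-- A characteristic function has norm at most `1`, so it can only equal `exp (c t² / 2)` at some
`t ≠ 0` if `c ≤ 0`. -/
lemma nonpos_of_charFun_eq_exp {μ : Measure ℝ} [IsProbabilityMeasure μ] {c t : ℝ} (ht : t ≠ 0)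
    (h : charFun μ t = Complex.exp ((c : ℂ) * (t : ℂ) ^ 2 / 2)) : c ≤ 0 := by
  have hle : ‖charFun μ t‖ ≤ 1 := norm_charFun_le_one t
  have hreal : (c : ℂ) * (t : ℂ) ^ 2 / 2 = ((c * t ^ 2 / 2 : ℝ) : ℂ) := by push_cast; rfl
  rw [h, hreal, Complex.norm_exp_ofReal, Real.exp_le_one_iff] at hle
  have : 0 < t ^ 2 := by positivity
  by_contra! hc
  linarith [mul_pos hc this]

/-- If the characteristic function of a probability measure `μ` on `ℝ` equals
`exp (c t² / 2)` on a neighborhood of `0`, then `c ≤ 0`, `μ` is the Gaussian `N(0, -c)`,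
and the identity extends to all of `ℝ`. -/
theorem gaussian_of_charFun_eq_near_zero (μ : Measure ℝ) [IsProbabilityMeasure μ]
    (c ε : ℝ) (hε : 0 < ε)
    (h : ∀ t : ℝ, |t| < ε → charFunM μ t = Complex.exp ((c : ℂ) * (t : ℂ) ^ 2 / 2)) :
    c ≤ 0 ∧ μ = gaussianReal 0 (-c).toNNReal ∧
      ∀ t : ℝ, charFunM μ t = Complex.exp ((c : ℂ) * (t : ℂ) ^ 2 / 2) := by
  simp_rw [charFunM_eq_charFun] at h ⊢
  have hc : c ≤ 0 := by
    refine nonpos_of_charFun_eq_exp (t := ε / 2) (by positivity) (h _ ?_)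
    rw [abs_of_pos (by positivity)]
    linarith
  have hμ : μ = gaussianReal 0 (-c).toNNReal :=
    ext_of_charFun_eq_near_zero hε
      (fun t ht ↦ by rw [h t ht, charFun_gaussianReal_zero_mean hc])
      integrableExpSet_id_gaussianReal
  exact ⟨hc, hμ, fun t ↦ by rw [hμ, charFun_gaussianReal_zero_mean hc]⟩
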